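/- In the degree-corrected stochastic block model setting (Θ ∈ ℝ^{n×r} a normalized membership matrix, B ∈ ℝ^{r×r} nonnegative with no zero row or column, D₁, D₂ positive diagonal, A = D₁ Θ B Θᵀ D₂, P and Q the row-stochastic normalizations of A and Aᵀ), let 0 ≤ β² < 1 and let S* ∈ ℝ^{n×n} be the unique solution of S − (β²/2)(P S Pᵀ + Q S Qᵀ) = PPᵀ + QQᵀ. Then: (i) whenever indices i and j belong to the same block of the partition, the i-th and j-th rows of S* are equal and the i-th and j-th columns of S* are equal; and (ii) if B is invertible, then rank(S*) = r. -/

import Mathlib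

open Matrix

/-- Size of the `p`-th block of the partition of `{1,…,n}` induced by the
block-assignment map `blk`. -/
def blockSize {n r : ℕ} (blk : Fin n → Fin r) (p : Fin r) : ℕ :=
  (Finset.univ.filter fun i => blk i = p).card

/-- Normalized membership matrix `Θ ∈ ℝ^{n×r}`: the `p`-th column is
`(1/√n_p)·χ^(p)`, where `χ^(p)` is the characteristic vector of block `p`
and `n_p` its size. Its columns are orthonormal. -/
noncomputable def Theta {n r : ℕ} (blk : Fin n → Fin r) :
    Matrix (Fin n) (Fin r) ℝ :=
  Matrix.of fun i p =>
    if blk i = p then (Real.sqrt (blockSize blk p))⁻¹ else 0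

/-- Row-stochastic normalization `D⁻¹ A` of a matrix `A`, where `D` is the
diagonal matrix of the row sums of `A`. -/
noncomputable def rowNormalize {n : ℕ} (A : Matrix (Fin n) (Fin n) ℝ) :
    Matrix (Fin n) (Fin n) ℝ :=
  Matrix.diagonal (fun i => (∑ j, A i j)⁻¹) * A

lemma blockSize_pos {n r : ℕ} (blk : Fin n → Fin r) (i : Fin n) : 0 < blockSize blk (blk i) :=
  Finset.card_pos.2 ⟨i, by simp⟩

lemma Theta_transpose_mul_self {n r : ℕ} (blk : Fin n → Fin r) (hblk : Function.Surjective blk) :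
    (Theta blk)ᵀ * Theta blk = 1 := by
  ext p q
  simp only [mul_apply, transpose_apply, Theta, of_apply, one_apply]
  split_ifs with h
  · subst h
    obtain ⟨i, rfl⟩ := hblk p
    have h0 : (0 : ℝ) < blockSize blk (blk i) := by exact_mod_cast blockSize_pos blk i
    simp only [ite_mul, zero_mul, mul_ite, mul_zero, ← ite_and, and_self, ← Finset.sum_filter,
      Finset.sum_const, nsmul_eq_mul]
    rw [← mul_inv, Real.mul_self_sqrt h0.le]
    exact mul_inv_cancel₀ h0.ne'
  · refine Finset.sum_eq_zero fun i _ => ?_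
    by_cases hi : blk i = p
    · simp [hi, h]
    · simp [hi]

/-- The entries of the degree-corrected block matrix `D₁ Θ B Θᵀ D₂`. -/
lemma blockMatrix_apply {n r : ℕ} (blk : Fin n → Fin r) (B : Matrix (Fin r) (Fin r) ℝ)
    (d₁ d₂ : Fin n → ℝ) (i j : Fin n) :
    (diagonal d₁ * (Theta blk * B * (Theta blk)ᵀ) * diagonal d₂) i j =
      d₁ i * ((Real.sqrt (blockSize blk (blk i)))⁻¹ * B (blk i) (blk j) *
        (Real.sqrt (blockSize blk (blk j)))⁻¹) * d₂ j := by
  rw [mul_diagonal, diagonal_mul]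
  simp [mul_apply, Theta]

lemma blockMatrix_nonneg {n r : ℕ} (blk : Fin n → Fin r) {B : Matrix (Fin r) (Fin r) ℝ}
    (hB : ∀ p q, 0 ≤ B p q) {d₁ d₂ : Fin n → ℝ} (hd₁ : ∀ i, 0 < d₁ i) (hd₂ : ∀ i, 0 < d₂ i)
    (i j : Fin n) :
    0 ≤ (diagonal d₁ * (Theta blk * B * (Theta blk)ᵀ) * diagonal d₂) i j := by
  rw [blockMatrix_apply]
  have := hB (blk i) (blk j)
  have := hd₁ i
  have := hd₂ j
  positivity

lemma blockMatrix_rowSum_pos {n r : ℕ} {blk : Fin n → Fin r} (hblk : Function.Surjective blk)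
    {B : Matrix (Fin r) (Fin r) ℝ} (hB : ∀ p q, 0 ≤ B p q) (hrow : ∀ p, ∃ q, 0 < B p q)
    {d₁ d₂ : Fin n → ℝ} (hd₁ : ∀ i, 0 < d₁ i) (hd₂ : ∀ i, 0 < d₂ i) (i : Fin n) :
    0 < ∑ j, (diagonal d₁ * (Theta blk * B * (Theta blk)ᵀ) * diagonal d₂) i j := by
  obtain ⟨q, hq⟩ := hrow (blk i)
  obtain ⟨j, rfl⟩ := hblk q
  refine Finset.sum_pos' (fun j _ => blockMatrix_nonneg blk hB hd₁ hd₂ i j)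
    ⟨j, Finset.mem_univ j, ?_⟩
  rw [blockMatrix_apply]
  have hi : (0 : ℝ) < blockSize blk (blk i) := by exact_mod_cast blockSize_pos blk i
  have hj : (0 : ℝ) < blockSize blk (blk j) := by exact_mod_cast blockSize_pos blk j
  have := hd₁ i
  have := hd₂ j
  positivity

lemma rowNormalize_apply {n : ℕ} (A : Matrix (Fin n) (Fin n) ℝ) (i j : Fin n) :
    rowNormalize A i j = (∑ k, A i k)⁻¹ * A i j := by
  simp [rowNormalize, diagonal_mul]

lemma rowNormalize_mem_rowStochastic {n : ℕ} {A : Matrix (Fin n) (Fin n) ℝ}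
    (hA : ∀ i j, 0 ≤ A i j) (hsum : ∀ i, 0 < ∑ j, A i j) :
    rowNormalize A ∈ rowStochastic ℝ (Fin n) := by
  rw [mem_rowStochastic_iff_sum]
  refine ⟨fun i j => ?_, fun i => ?_⟩
  · rw [rowNormalize_apply]
    exact mul_nonneg (inv_nonneg.2 (hsum i).le) (hA i j)
  · simp_rw [rowNormalize_apply, ← Finset.mul_sum]
    exact inv_mul_cancel₀ (hsum i).ne'

/-- Row normalization cancels the left degree correction. -/
lemma rowNormalize_blockMatrix_row_eq {n r : ℕ} (blk : Fin n → Fin r)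
    (B : Matrix (Fin r) (Fin r) ℝ) {d₁ : Fin n → ℝ} (d₂ : Fin n → ℝ) (hd₁ : ∀ i, 0 < d₁ i)
    {i j : Fin n} (hij : blk i = blk j) :
    rowNormalize (diagonal d₁ * (Theta blk * B * (Theta blk)ᵀ) * diagonal d₂) i =
      rowNormalize (diagonal d₁ * (Theta blk * B * (Theta blk)ᵀ) * diagonal d₂) j := by
  ext k
  simp only [rowNormalize_apply, blockMatrix_apply]
  simp only [mul_assoc, ← Finset.mul_sum, mul_inv, hij]
  have hi := (hd₁ i).ne'
  have hj := (hd₁ j).ne'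
  field_simp

lemma rank_le_rank_rowNormalize {n : ℕ} {A : Matrix (Fin n) (Fin n) ℝ}
    (hsum : ∀ i, 0 < ∑ j, A i j) : A.rank ≤ (rowNormalize A).rank := by
  have h : A = diagonal (fun i => ∑ j, A i j) * rowNormalize A := by
    ext i j
    rw [diagonal_mul, rowNormalize_apply, mul_inv_cancel_left₀ (hsum i).ne']
  conv_lhs => rw [h]
  exact rank_mul_le_right _ _

lemma rank_le_rank_blockMatrix {n r : ℕ} {blk : Fin n → Fin r} (hblk : Function.Surjective blk)
    (B : Matrix (Fin r) (Fin r) ℝ) {d₁ d₂ : Fin n → ℝ} (hd₁ : ∀ i, 0 < d₁ i)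
    (hd₂ : ∀ i, 0 < d₂ i) :
    B.rank ≤ (diagonal d₁ * (Theta blk * B * (Theta blk)ᵀ) * diagonal d₂).rank := by
  have hu : ∀ {d : Fin n → ℝ}, (∀ i, 0 < d i) → IsUnit (diagonal d).det := fun {d} hd => by
    rw [det_diagonal]
    exact (Finset.prod_pos fun i _ => hd i).ne'.isUnit
  rw [rank_mul_eq_left_of_isUnit_det _ _ (hu hd₂), rank_mul_eq_right_of_isUnit_det _ _ (hu hd₁)]
  have h : B = (Theta blk)ᵀ * (Theta blk * B * (Theta blk)ᵀ) * Theta blk := by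
    simp only [← Matrix.mul_assoc, Theta_transpose_mul_self blk hblk, Matrix.one_mul]
    rw [Matrix.mul_assoc, Theta_transpose_mul_self blk hblk, Matrix.mul_one]
  conv_lhs => rw [h]
  exact (rank_mul_le_left _ _).trans (rank_mul_le_right _ _)

/-- A matrix whose rows are constant on the blocks of a partition into `r` blocks has rank at
most `r`. -/
lemma rank_le_of_row_eq {n r : ℕ} {blk : Fin n → Fin r} (hblk : Function.Surjective blk)
    {S : Matrix (Fin n) (Fin n) ℝ} (hS : ∀ i j, blk i = blk j → S i = S j) : S.rank ≤ r := by
  have h : S = (1 : Matrix (Fin r) (Fin r) ℝ).submatrix blk id *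
      S.submatrix (Function.surjInv hblk) id := by
    ext i j
    simpa [mul_apply, one_apply] using
      congrFun (hS i _ (Function.surjInv_eq hblk (blk i)).symm) j
  rw [h]
  exact (rank_mul_le_left _ _).trans (rank_le_width _)

lemma mul_row_eq {l m o R : Type*} [Fintype m] [NonUnitalNonAssocSemiring R] {M : Matrix l m R}
    (N : Matrix m o R) {i j : l} (h : M i = M j) (k : o) : (M * N) i k = (M * N) j k := by
  simp [mul_apply, h]

lemma sum_abs_transpose_mulVec_le {ι : Type*} [Fintype ι] [DecidableEq ι] {P : Matrix ι ι ℝ}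
    (hP : P ∈ rowStochastic ℝ ι) (x : ι → ℝ) : ∑ i, |(Pᵀ *ᵥ x) i| ≤ ∑ i, |x i| := by
  rw [mem_rowStochastic_iff_sum] at hP
  calc ∑ i, |(Pᵀ *ᵥ x) i| ≤ ∑ i, ∑ j, P j i * |x j| := by
        refine Finset.sum_le_sum fun i _ => (Finset.abs_sum_le_sum_abs _ _).trans_eq ?_
        exact Finset.sum_congr rfl fun j _ => by
          simp [abs_mul, abs_of_nonneg (hP.1 j i)]
    _ = ∑ i, |x i| := by
        rw [Finset.sum_comm]
        exact Finset.sum_congr rfl fun j _ => by rw [← Finset.sum_mul, hP.2 j, one_mul]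

lemma dotProduct_mul_mul_transpose_mulVec {ι : Type*} [Fintype ι] (P S : Matrix ι ι ℝ)
    (x : ι → ℝ) : x ⬝ᵥ (P * S * Pᵀ) *ᵥ x = (Pᵀ *ᵥ x) ⬝ᵥ S *ᵥ (Pᵀ *ᵥ x) := by
  rw [← mulVec_mulVec, ← mulVec_mulVec, dotProduct_mulVec, mulVec_transpose]

lemma neg_sum_abs_mul_sq_le_dotProduct_mulVec {ι : Type*} [Fintype ι] (S : Matrix ι ι ℝ)
    (x : ι → ℝ) : -((∑ i, ∑ j, |S i j|) * (∑ i, |x i|) ^ 2) ≤ x ⬝ᵥ S *ᵥ x := by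
  have hx : ∀ i, |x i| ≤ ∑ j, |x j| := fun i =>
    Finset.single_le_sum (f := fun j => |x j|) (fun _ _ => abs_nonneg _) (Finset.mem_univ i)
  refine neg_le_of_abs_le ?_
  simp only [dotProduct, mulVec, Finset.mul_sum, Finset.sum_mul]
  refine (Finset.abs_sum_le_sum_abs _ _).trans (Finset.sum_le_sum fun i _ =>
    (Finset.abs_sum_le_sum_abs _ _).trans (Finset.sum_le_sum fun j _ => ?_))
  rw [abs_mul, abs_mul, mul_left_comm, sq]
  gcongr
  · exact hx i
  · exact hx j

/-- If the quadratic form of `S` dominates a strict `ℓ¹`-contractive average of its own pullbacks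
along transposed stochastic matrices, then it is nonnegative. -/
lemma dotProduct_mulVec_nonneg_of_contraction {ι : Type*} [Fintype ι] [DecidableEq ι]
    {P Q S : Matrix ι ι ℝ} (hP : P ∈ rowStochastic ℝ ι) (hQ : Q ∈ rowStochastic ℝ ι) {c : ℝ}
    (hc₀ : 0 ≤ c) (hc₁ : c < 1)
    (hS : ∀ x, c / 2 * ((Pᵀ *ᵥ x) ⬝ᵥ S *ᵥ (Pᵀ *ᵥ x) + (Qᵀ *ᵥ x) ⬝ᵥ S *ᵥ (Qᵀ *ᵥ x)) ≤
      x ⬝ᵥ S *ᵥ x) (x : ι → ℝ) : 0 ≤ x ⬝ᵥ S *ᵥ x := by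
  set K := ∑ i, ∑ j, |S i j|
  have hK₀ : 0 ≤ K := by positivity
  have key : ∀ (k : ℕ) (y : ι → ℝ), -(c ^ k * (K * (∑ i, |y i|) ^ 2)) ≤ y ⬝ᵥ S *ᵥ y := by
    intro k
    induction k with
    | zero => intro y; simpa using neg_sum_abs_mul_sq_le_dotProduct_mulVec S y
    | succ k ih =>
      intro y
      have step : ∀ {R : Matrix ι ι ℝ}, R ∈ rowStochastic ℝ ι →
          -(c ^ k * (K * (∑ i, |y i|) ^ 2)) ≤ (Rᵀ *ᵥ y) ⬝ᵥ S *ᵥ (Rᵀ *ᵥ y) := fun {R} hR => by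
        refine le_trans (neg_le_neg ?_) (ih (Rᵀ *ᵥ y))
        gcongr _ * (_ * ?_ ^ 2)
        exact sum_abs_transpose_mulVec_le hR y
      calc -(c ^ (k + 1) * (K * (∑ i, |y i|) ^ 2))
          = c / 2 * (-(c ^ k * (K * (∑ i, |y i|) ^ 2)) +
              -(c ^ k * (K * (∑ i, |y i|) ^ 2))) := by ring
        _ ≤ _ := mul_le_mul_of_nonneg_left (add_le_add (step hP) (step hQ)) (by positivity)
        _ ≤ _ := hS y
  have hlim := ((tendsto_pow_atTop_nhds_zero_of_lt_one hc₀ hc₁).mul_const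
    (K * (∑ i, |x i|) ^ 2)).neg
  rw [zero_mul, neg_zero] at hlim
  exact le_of_tendsto' hlim fun k => key k x

lemma rank_le_rank_of_mulVec_eq_zero_imp {m m' n : Type*} [Fintype n] [Fintype m] [Fintype m']
    {M : Matrix m n ℝ} {N : Matrix m' n ℝ} (h : ∀ x, N *ᵥ x = 0 → M *ᵥ x = 0) :
    M.rank ≤ N.rank := by
  have hker : LinearMap.ker N.mulVecLin ≤ LinearMap.ker M.mulVecLin := fun x hx => h x hx
  have hle := Submodule.finrank_mono hker
  have hM := LinearMap.finrank_range_add_finrank_ker M.mulVecLin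
  have hN := LinearMap.finrank_range_add_finrank_ker N.mulVecLin
  simp only [Matrix.rank]
  omega

/-- A solution of `S - (c/2)(P S Pᵀ + Q S Qᵀ) = P Pᵀ + Q Qᵀ` has rank at least that of `P`. -/
lemma rank_le_rank_of_stein_eq {ι : Type*} [Fintype ι] [DecidableEq ι]
    {P Q S : Matrix ι ι ℝ} (hP : P ∈ rowStochastic ℝ ι) (hQ : Q ∈ rowStochastic ℝ ι) {c : ℝ}
    (hc₀ : 0 ≤ c) (hc₁ : c < 1)
    (hS : S - (c / 2) • (P * S * Pᵀ + Q * S * Qᵀ) = P * Pᵀ + Q * Qᵀ) : P.rank ≤ S.rank := by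
  have hgram : ∀ (R : Matrix ι ι ℝ) x, x ⬝ᵥ (R * Rᵀ) *ᵥ x = (Rᵀ *ᵥ x) ⬝ᵥ (Rᵀ *ᵥ x) :=
    fun R x => by simpa using dotProduct_mul_mul_transpose_mulVec R 1 x
  have hnonneg : ∀ y : ι → ℝ, 0 ≤ y ⬝ᵥ y := fun y =>
    Finset.sum_nonneg fun i _ => mul_self_nonneg (y i)
  have hform : ∀ x, x ⬝ᵥ S *ᵥ x =
      c / 2 * ((Pᵀ *ᵥ x) ⬝ᵥ S *ᵥ (Pᵀ *ᵥ x) + (Qᵀ *ᵥ x) ⬝ᵥ S *ᵥ (Qᵀ *ᵥ x)) +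
        ((Pᵀ *ᵥ x) ⬝ᵥ (Pᵀ *ᵥ x) + (Qᵀ *ᵥ x) ⬝ᵥ (Qᵀ *ᵥ x)) := fun x => by
    have h := congrArg (fun M => x ⬝ᵥ M *ᵥ x) hS
    simp only [sub_mulVec, smul_mulVec, add_mulVec, dotProduct_sub, dotProduct_smul,
      dotProduct_add, dotProduct_mul_mul_transpose_mulVec, hgram, smul_eq_mul] at h
    linarith
  have hpos := dotProduct_mulVec_nonneg_of_contraction hP hQ hc₀ hc₁ fun x => by
    rw [hform x]
    exact le_add_of_nonneg_right (add_nonneg (hnonneg _) (hnonneg _))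
  rw [← rank_transpose P]
  refine rank_le_rank_of_mulVec_eq_zero_imp fun x hx => ?_
  have h := hform x
  rw [hx, dotProduct_zero] at h
  have hfirst := mul_nonneg (div_nonneg hc₀ zero_le_two)
    (add_nonneg (hpos (Pᵀ *ᵥ x)) (hpos (Qᵀ *ᵥ x)))
  exact dotProduct_self_eq_zero.1
    (le_antisymm (by linarith [hnonneg (Qᵀ *ᵥ x)]) (hnonneg (Pᵀ *ᵥ x)))

/-- Theorem: in the degree-corrected SBM setting with `0 ≤ β² < 1`, let `S*`
be the unique solution of `S − (β²/2)(P S Pᵀ + Q S Qᵀ) = PPᵀ + QQᵀ`. Then: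
(i) if `i` and `j` belong to the same block, the `i`-th and `j`-th rows of
`S*` coincide, as do its `i`-th and `j`-th columns; and
(ii) if `B` is invertible, `rank(S*) = r`. -/
theorem Sstar_block_structure_and_rank {n r : ℕ}
    (blk : Fin n → Fin r) (hblk : Function.Surjective blk)
    (B : Matrix (Fin r) (Fin r) ℝ)
    (hBnn : ∀ p q, 0 ≤ B p q)
    (hBrow : ∀ p, ∃ q, 0 < B p q) (hBcol : ∀ q, ∃ p, 0 < B p q)
    (d₁ d₂ : Fin n → ℝ) (hd₁ : ∀ i, 0 < d₁ i) (hd₂ : ∀ i, 0 < d₂ i)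
    (A P Q : Matrix (Fin n) (Fin n) ℝ)
    (hA : A = Matrix.diagonal d₁ * (Theta blk * B * (Theta blk)ᵀ) *
      Matrix.diagonal d₂)
    (hP : P = rowNormalize A) (hQ : Q = rowNormalize Aᵀ)
    (β : ℝ) (hβ : β ^ 2 < 1)
    (Sstar : Matrix (Fin n) (Fin n) ℝ)
    (hS : Sstar - (β ^ 2 / 2) • (P * Sstar * Pᵀ + Q * Sstar * Qᵀ) =
      P * Pᵀ + Q * Qᵀ) :
    (∀ i j : Fin n, blk i = blk j →
      (∀ k, Sstar i k = Sstar j k) ∧ (∀ k, Sstar k i = Sstar k j)) ∧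
    (IsUnit B.det → Sstar.rank = r) := by
  have hAt : Aᵀ = diagonal d₂ * (Theta blk * Bᵀ * (Theta blk)ᵀ) * diagonal d₁ := by
    simp [hA, transpose_mul, Matrix.mul_assoc]
  have hBtnn : ∀ p q, 0 ≤ Bᵀ p q := fun p q => hBnn q p
  have hsum : ∀ i, 0 < ∑ j, A i j := hA ▸ blockMatrix_rowSum_pos hblk hBnn hBrow hd₁ hd₂
  have hsumt : ∀ i, 0 < ∑ j, Aᵀ i j := hAt ▸ blockMatrix_rowSum_pos hblk hBtnn hBcol hd₂ hd₁
  have hPst : P ∈ rowStochastic ℝ (Fin n) := hP ▸ rowNormalize_mem_rowStochastic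
    (hA ▸ blockMatrix_nonneg blk hBnn hd₁ hd₂) hsum
  have hQst : Q ∈ rowStochastic ℝ (Fin n) := hQ ▸ rowNormalize_mem_rowStochastic
    (hAt ▸ blockMatrix_nonneg blk hBtnn hd₂ hd₁) hsumt
  have hProw : ∀ i j, blk i = blk j → P i = P j := fun i j hij => by
    rw [hP, hA]
    exact rowNormalize_blockMatrix_row_eq blk B d₂ hd₁ hij
  have hQrow : ∀ i j, blk i = blk j → Q i = Q j := fun i j hij => by
    rw [hQ, hAt]
    exact rowNormalize_blockMatrix_row_eq blk Bᵀ d₁ hd₂ hij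
  have hrows : ∀ T : Matrix (Fin n) (Fin n) ℝ,
      T - (β ^ 2 / 2) • (P * T * Pᵀ + Q * T * Qᵀ) = P * Pᵀ + Q * Qᵀ →
      ∀ i j, blk i = blk j → T i = T j := fun T hT i j hij => by
    rw [sub_eq_iff_eq_add.1 hT]
    ext k
    simp only [Matrix.add_apply, Matrix.smul_apply, Matrix.mul_assoc, mul_row_eq _ (hProw i j hij),
      mul_row_eq _ (hQrow i j hij)]
  have hSt : Sstarᵀ - (β ^ 2 / 2) • (P * Sstarᵀ * Pᵀ + Q * Sstarᵀ * Qᵀ) =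
      P * Pᵀ + Q * Qᵀ := by
    simpa [transpose_mul, Matrix.mul_assoc] using congrArg transpose hS
  refine ⟨fun i j hij => ⟨congrFun (hrows _ hS i j hij), congrFun (hrows _ hSt i j hij)⟩,
    fun hB => le_antisymm (rank_le_of_row_eq hblk (hrows _ hS)) ?_⟩
  calc r = B.rank := by
        rw [rank_of_isUnit _ ((isUnit_iff_isUnit_det _).2 hB), Fintype.card_fin]
    _ ≤ A.rank := hA ▸ rank_le_rank_blockMatrix hblk B hd₁ hd₂
    _ ≤ P.rank := hP ▸ rank_le_rank_rowNormalize hsum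
    _ ≤ Sstar.rank := rank_le_rank_of_stein_eq hPst hQst (sq_nonneg β) hβ hS
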